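/- arXiv:2503.16823 — 9 statements merged into one kernel-verified Lean document; each statement's English description precedes it below -/
import Mathlib

section
/- Let B and N be finite types with decidable equality, let U : B → Finset N → ℝ be coalition utility functions, and let n : N. If two coalition partitions CP, CP' : B → Finset N satisfy CP b \ {n} = CP' b \ {n} for every b : B (i.e., they differ only in which coalitions contain the sensor n), then the change in the coalitional utility of n equals the change in the total utility: U_n(CP) − U_n(CP') = ζ(CP) − ζ(CP'). (Hence the lower-layer overlapping coalition formation game is an exact potential game with potential function ζ.) -/
/-- Total utility (potential) of a coalition partition. -/
noncomputable def totalUtility {B N : Type*} [Fintype B]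
    (U : B → Finset N → ℝ) (CP : B → Finset N) : ℝ :=
  ∑ b : B, U b (CP b)

/-- Coalitional utility of sensor `n` under partition `CP`. -/
noncomputable def sensorUtility {B N : Type*} [Fintype B] [DecidableEq N]
    (U : B → Finset N → ℝ) (n : N) (CP : B → Finset N) : ℝ :=
  ∑ b ∈ Finset.univ.filter (fun b => n ∈ CP b), (U b (CP b) - U b (CP b \ {n}))

/-- The sensor utility is the total utility minus the total utility with `n` removed. -/
theorem sensorUtility_eq_sub
    {B N : Type*} [Fintype B] [DecidableEq N]
    (U : B → Finset N → ℝ) (n : N) (CP : B → Finset N) :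
    sensorUtility U n CP =
      totalUtility U CP - totalUtility U (fun b => CP b \ {n}) := by
  unfold sensorUtility totalUtility
  rw [← Finset.sum_sub_distrib, Finset.sum_filter]
  refine Finset.sum_congr rfl fun b _ => ?_
  split_ifs with hb
  · rfl
  · simp [Finset.sdiff_singleton_eq_erase, Finset.erase_eq_of_notMem hb]

/-- If two coalition partitions differ only in which coalitions contain the sensor `n`,
then the change in the coalitional utility of `n` equals the change in the total
utility (exact potential game property). -/
theorem sensorUtility_sub_eq_totalUtility_sub
    {B N : Type*} [Fintype B] [Fintype N] [DecidableEq B] [DecidableEq N]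
    (U : B → Finset N → ℝ) (n : N) (CP CP' : B → Finset N)
    (h : ∀ b : B, CP b \ {n} = CP' b \ {n}) :
    sensorUtility U n CP - sensorUtility U n CP' =
      totalUtility U CP - totalUtility U CP' := by
  rw [sensorUtility_eq_sub, sensorUtility_eq_sub, funext h]
  ring
end

section
/- Let B and N be finite types with decidable equality, U : B → Finset N → ℝ, n : N, and CP : B → Finset N a coalition partition. Let a, a' : B with a ≠ a', n ∈ CP a and n ∉ CP a'. Let CP' be the partition obtained by transferring n from coalition a to coalition a': CP' a = CP a \ {n}, CP' a' = insert n (CP a'), and CP' b = CP b for all b distinct from a and a'. Then U_n(CP) − U_n(CP') = ζ(CP) − ζ(CP') = (U a (CP a) − U a (CP a \ {n})) − (U a' (insert n (CP a')) − U a' (CP a')). -/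
/-- Transferring sensor `n` from coalition `a` to coalition `a'`: the change in
the coalitional utility of `n` equals the change in the total utility, and both
equal the explicit difference of the marginal contributions. -/
theorem transfer_utility_change
    {B N : Type*} [Fintype B] [Fintype N] [DecidableEq B] [DecidableEq N]
    (U : B → Finset N → ℝ) (n : N) (CP CP' : B → Finset N)
    (a a' : B) (hne : a ≠ a') (hmem : n ∈ CP a) (hmem' : n ∉ CP a')
    (ha : CP' a = CP a \ {n}) (ha' : CP' a' = insert n (CP a'))
    (hother : ∀ b : B, b ≠ a → b ≠ a' → CP' b = CP b) :
    sensorUtility U n CP - sensorUtility U n CP' =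
        totalUtility U CP - totalUtility U CP' ∧
      totalUtility U CP - totalUtility U CP' =
        (U a (CP a) - U a (CP a \ {n})) -
          (U a' (insert n (CP a')) - U a' (CP a')) := by
  have key : ∀ C : B → Finset N, sensorUtility U n C =
      totalUtility U C - ∑ b : B, U b (C b \ {n}) := by
    intro C
    unfold sensorUtility totalUtility
    rw [Finset.sum_filter, ← Finset.sum_sub_distrib]
    refine Finset.sum_congr rfl fun b _ => ?_
    split_ifs with h
    · rfl
    · rw [Finset.sdiff_eq_self_of_disjoint (Finset.disjoint_singleton_right.mpr h), sub_self]
  have hsd : ∀ b, CP' b \ {n} = CP b \ {n} := by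
    intro b
    by_cases h1 : b = a
    · subst h1
      rw [ha]
      ext x
      simp
    · by_cases h2 : b = a'
      · subst h2
        rw [ha']
        ext x
        simp only [Finset.mem_sdiff, Finset.mem_insert, Finset.mem_singleton]
        tauto
      · rw [hother b h1 h2]
  constructor
  · rw [key, key]
    simp only [hsd]
    ring
  · unfold totalUtility
    rw [← Finset.sum_sub_distrib, Fintype.sum_eq_add a a' hne, ha, ha']
    · ring
    · rintro b ⟨h1, h2⟩
      rw [hother b h1 h2, sub_self]
end

section
/- Let B and N be finite types with decidable equality, U : B → Finset N → ℝ, n : N, and CP : B → Finset N a coalition partition. Let a : B with n ∉ CP a, and let CP' = Function.update CP a (insert n (CP a)) be the partition obtained when n joins coalition a as an overlap. Then U_n(CP) − U_n(CP') = ζ(CP) − ζ(CP') = U a (CP a) − U a (insert n (CP a)). -/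
/-- When sensor `n` joins coalition `a` as an overlap: the change in the
coalitional utility of `n` equals the change in the total utility, and both
equal `U a (CP a) - U a (insert n (CP a))`. -/
theorem join_utility_change
    {B N : Type*} [Fintype B] [Fintype N] [DecidableEq B] [DecidableEq N]
    (U : B → Finset N → ℝ) (n : N) (CP : B → Finset N)
    (a : B) (hmem : n ∉ CP a) :
    sensorUtility U n CP
        - sensorUtility U n (Function.update CP a (insert n (CP a))) =
      totalUtility U CP
        - totalUtility U (Function.update CP a (insert n (CP a))) ∧
    totalUtility U CP
        - totalUtility U (Function.update CP a (insert n (CP a))) =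
      U a (CP a) - U a (insert n (CP a)) := by
  have hsum : ∀ f g : B → ℝ, (∀ b, b ≠ a → f b = g b) →
      ∑ b, f b - ∑ b, g b = f a - g a := by
    intro f g h
    rw [← Finset.sum_sub_distrib]
    apply Finset.sum_eq_single a
    · intro b _ hb
      rw [h b hb, sub_self]
    · intro h
      exact absurd (Finset.mem_univ a) h
  have htot : totalUtility U CP
        - totalUtility U (Function.update CP a (insert n (CP a))) =
      U a (CP a) - U a (insert n (CP a)) := by
    unfold totalUtility
    rw [hsum]
    · simp
    · intro b hb
      simp [hb]
  refine ⟨?_, htot⟩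
  rw [htot]
  unfold sensorUtility
  rw [Finset.sum_filter, Finset.sum_filter, hsum]
  · have h : insert n (CP a) \ {n} = CP a := by
      ext x
      simp only [Finset.mem_sdiff, Finset.mem_insert, Finset.mem_singleton]
      grind
    simp [hmem, h]
  · intro b hb
    simp [hb]
end

section
/- Let B and N be finite types with decidable equality, U : B → Finset N → ℝ, n : N, and CP : B → Finset N a coalition partition. Let a : B with n ∈ CP a, and let CP' = Function.update CP a (CP a \ {n}) be the partition obtained when n unilaterally quits coalition a. Then U_n(CP) − U_n(CP') = ζ(CP) − ζ(CP') = U a (CP a) − U a (CP a \ {n}). -/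
/-- When sensor `n` unilaterally quits coalition `a`: the change in the
coalitional utility of `n` equals the change in the total utility, and both
equal `U a (CP a) - U a (CP a \ {n})`. -/
theorem quit_utility_change
    {B N : Type*} [Fintype B] [Fintype N] [DecidableEq B] [DecidableEq N]
    (U : B → Finset N → ℝ) (n : N) (CP : B → Finset N)
    (a : B) (hmem : n ∈ CP a) :
    sensorUtility U n CP
        - sensorUtility U n (Function.update CP a (CP a \ {n})) =
      totalUtility U CP
        - totalUtility U (Function.update CP a (CP a \ {n})) ∧
    totalUtility U CP
        - totalUtility U (Function.update CP a (CP a \ {n})) =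
      U a (CP a) - U a (CP a \ {n}) := by
  have h2 : totalUtility U CP
        - totalUtility U (Function.update CP a (CP a \ {n})) =
      U a (CP a) - U a (CP a \ {n}) := by
    unfold totalUtility
    rw [← Finset.sum_sub_distrib, Finset.sum_eq_single a]
    · simp
    · intro b _ hb
      simp [Function.update_of_ne hb]
    · simp
  refine ⟨?_, h2⟩
  rw [h2]
  unfold sensorUtility
  rw [Finset.sum_filter, Finset.sum_filter, ← Finset.sum_sub_distrib,
    Finset.sum_eq_single a]
  · simp [hmem]
  · intro b _ hb
    simp [Function.update_of_ne hb]
  · simp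
end

section
/- Let B and N be finite types with decidable equality, U : B → Finset N → ℝ, n : N, and CP : B → Finset N a coalition partition. Let a, a' : B with a ≠ a', n ∈ CP a and n ∉ CP a', and let CP' be the partition obtained by transferring n from coalition a to coalition a' (CP' a = CP a \ {n}, CP' a' = insert n (CP a'), CP' b = CP b otherwise). If the transferring rule holds, i.e., U a' (insert n (CP a')) − U a' (CP a') ≥ max 0 (U a (CP a) − U a (CP a \ {n})), then U a' (insert n (CP a')) + U a (CP a \ {n}) ≥ U a (CP a) + U a' (CP a'), and consequently the total utility does not decrease: ζ(CP') ≥ ζ(CP). -/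
/-- If the transferring rule holds for moving sensor `n` from coalition `a` to
coalition `a'`, then the total utility of the two affected coalitions does not
decrease, and consequently the total utility of all edge servers does not
decrease. -/
theorem transfer_rule_totalUtility_nondecreasing
    {B N : Type*} [Fintype B] [Fintype N] [DecidableEq B] [DecidableEq N]
    (U : B → Finset N → ℝ) (n : N) (CP CP' : B → Finset N)
    (a a' : B) (hne : a ≠ a') (hmem : n ∈ CP a) (hmem' : n ∉ CP a')
    (ha : CP' a = CP a \ {n}) (ha' : CP' a' = insert n (CP a'))
    (hother : ∀ b : B, b ≠ a → b ≠ a' → CP' b = CP b)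
    (hrule : U a' (insert n (CP a')) - U a' (CP a') ≥
      max 0 (U a (CP a) - U a (CP a \ {n}))) :
    U a' (insert n (CP a')) + U a (CP a \ {n}) ≥ U a (CP a) + U a' (CP a') ∧
      totalUtility U CP' ≥ totalUtility U CP := by
  have h2 := (le_max_right _ _).trans hrule
  have h1 : U a' (insert n (CP a')) + U a (CP a \ {n}) ≥ U a (CP a) + U a' (CP a') := by
    linarith
  refine ⟨h1, ?_⟩
  have key : ∀ f : B → ℝ, ∑ b, f b =
      f a + (f a' + ∑ b ∈ (Finset.univ.erase a).erase a', f b) := by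
    intro f
    rw [Finset.add_sum_erase _ f (by simp [hne.symm]), Finset.add_sum_erase _ f (by simp)]
  have h3 : ∑ b ∈ (Finset.univ.erase a).erase a', U b (CP' b) =
      ∑ b ∈ (Finset.univ.erase a).erase a', U b (CP b) := by
    refine Finset.sum_congr rfl fun b hb => ?_
    simp only [Finset.mem_erase] at hb
    rw [hother b hb.2.1 hb.1]
  unfold totalUtility
  rw [key, key (fun b => U b (CP b)), h3, ha, ha']
  linarith
end

section
/- Let B and N be finite types with decidable equality, U : B → Finset N → ℝ, and n : N. If coalition partitions CP, CP' : B → Finset N satisfy CP b \ {n} = CP' b \ {n} for every b : B, and the switch from CP to CP' strictly increases the coalitional utility of n, i.e., U_n(CP') > U_n(CP), then the total utility strictly increases: ζ(CP') > ζ(CP). -/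
/-- If two coalition partitions differ only in which coalitions contain sensor
`n`, and the switch from `CP` to `CP'` strictly increases the coalitional
utility of `n`, then the total utility strictly increases. -/
theorem strict_improvement_totalUtility
    {B N : Type*} [Fintype B] [Fintype N] [DecidableEq B] [DecidableEq N]
    (U : B → Finset N → ℝ) (n : N) (CP CP' : B → Finset N)
    (h : ∀ b : B, CP b \ {n} = CP' b \ {n})
    (himp : sensorUtility U n CP' > sensorUtility U n CP) :
    totalUtility U CP' > totalUtility U CP := by
  have key : ∀ C : B → Finset N,
      sensorUtility U n C = totalUtility U C - ∑ b : B, U b (C b \ {n}) := by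
    intro C
    unfold sensorUtility totalUtility
    rw [← Finset.sum_sub_distrib, Finset.sum_filter]
    refine Finset.sum_congr rfl fun b _ => ?_
    split_ifs with hb
    · rfl
    · rw [Finset.sdiff_singleton_eq_erase, Finset.erase_eq_of_notMem hb, sub_self]
  rw [key, key] at himp
  simp only [h] at himp
  linarith
end

section
/- In an exact potential game in which each strategy type S i is finite and nonempty, the potential φ attains a maximum over the (finite, nonempty) profile space, and every profile s* maximizing φ is a pure Nash equilibrium; in particular, a pure Nash equilibrium exists. -/
/-- In an exact potential game with finite nonempty strategy spaces, the
potential attains a maximum over the profile space, every potential-maximizing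
profile is a pure Nash equilibrium, and in particular a pure Nash equilibrium
exists. -/
theorem potential_game_nash_exists
    {I : Type*} [Fintype I] [DecidableEq I] {S : I → Type*}
    [∀ i, Fintype (S i)] [∀ i, Nonempty (S i)]
    (u : I → (∀ j, S j) → ℝ) (φ : (∀ j, S j) → ℝ)
    (hpot : ∀ (i : I) (s : ∀ j, S j) (x : S i),
      u i (Function.update s i x) - u i s =
        φ (Function.update s i x) - φ s) :
    (∃ s : ∀ j, S j, ∀ t : ∀ j, S j, φ t ≤ φ s) ∧
    (∀ s : ∀ j, S j, (∀ t : ∀ j, S j, φ t ≤ φ s) →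
      ∀ (i : I) (x : S i), u i (Function.update s i x) ≤ u i s) ∧
    (∃ s : ∀ j, S j, ∀ (i : I) (x : S i),
      u i (Function.update s i x) ≤ u i s) := by
  have hmax : ∃ s : ∀ j, S j, ∀ t : ∀ j, S j, φ t ≤ φ s := Finite.exists_max φ
  have hnash : ∀ s : ∀ j, S j, (∀ t : ∀ j, S j, φ t ≤ φ s) →
      ∀ (i : I) (x : S i), u i (Function.update s i x) ≤ u i s := by
    intro s hs i x
    have h1 := hpot i s x
    have h2 := hs (Function.update s i x)
    linarith
  obtain ⟨s, hs⟩ := hmax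
  exact ⟨⟨s, hs⟩, hnash, s, hnash s hs⟩
end

section
/- In an exact potential game in which each strategy type S i is finite, there is no infinite strict improvement path: there do not exist a sequence of profiles s : ℕ → (Π j, S j), a sequence of players i : ℕ → I, and strategies x : Π k, S (i k) such that for every k, s (k+1) = Function.update (s k) (i k) (x k) and u (i k) (s (k+1)) > u (i k) (s k). Hence every sequence of strict unilateral improvements terminates after finitely many steps. -/
/-- In an exact potential game with finite strategy spaces, there is no
infinite strict unilateral improvement path: every sequence of strict
unilateral improvements terminates after finitely many steps. -/
theorem potential_game_no_infinite_improvement_path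
    {I : Type*} [Fintype I] [DecidableEq I] {S : I → Type*}
    [∀ i, Fintype (S i)]
    (u : I → (∀ j, S j) → ℝ) (φ : (∀ j, S j) → ℝ)
    (hpot : ∀ (i : I) (s : ∀ j, S j) (x : S i),
      u i (Function.update s i x) - u i s =
        φ (Function.update s i x) - φ s) :
    ¬ ∃ (s : ℕ → ∀ j, S j) (i : ℕ → I) (x : ∀ k : ℕ, S (i k)),
      ∀ k : ℕ, s (k + 1) = Function.update (s k) (i k) (x k) ∧
        u (i k) (s (k + 1)) > u (i k) (s k) := by
  rintro ⟨s, i, x, h⟩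
  have hmono : StrictMono (fun k => φ (s k)) := by
    refine strictMono_nat_of_lt_succ fun k => ?_
    obtain ⟨h1, h2⟩ := h k
    have h3 := hpot (i k) (s k) (x k)
    rw [← h1] at h3
    show φ (s k) < φ (s (k + 1))
    linarith
  have hinj : Function.Injective s := fun a b hab =>
    hmono.injective (congrArg φ hab)
  exact not_injective_infinite_finite s hinj
end

section
/- Let C (partial-DTs) and B (edge servers) be finite types with Fintype.card C ≤ Fintype.card B, and let preferences be given by ranking values pC : C → B → ℝ and pB : B → C → ℝ. Then there exists an injective assignment Φ : C → B that is stable, i.e., there is no blocking pair: there do not exist c : C and b : B such that pC c b > pC c (Φ c) and, for every c' : C with Φ c' = b, pB b c > pB b c'. (Existence of a stable one-to-one matching of all partial-DTs to edge servers.) -/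
/-- Invariant of deferred acceptance: `P` is the set of proposals made so far and `m` the
current partial matching. -/
def DAInv {C B : Type*} (pC : C → B → ℝ) (pB : B → C → ℝ)
    (P : Finset (C × B)) (m : C → Option B) : Prop :=
  (∀ c c' b, m c = some b → m c' = some b → c = c') ∧
  (∀ c b b', m c = some b → pC c b < pC c b' → (c, b') ∈ P) ∧
  (∀ c b, (c, b) ∈ P → ∃ c', m c' = some b ∧ pB b c ≤ pB b c')

/-- If some `c` is unmatched, one more proposal can be made. -/
lemma DAInv.step {C B : Type*} [Fintype C] [Fintype B] [DecidableEq C] [DecidableEq B]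
    (hcard : Fintype.card C ≤ Fintype.card B)
    (pC : C → B → ℝ) (pB : B → C → ℝ) (P : Finset (C × B)) (m : C → Option B)
    (h : DAInv pC pB P m) (c : C) (hc : m c = none) :
    ∃ P' m', DAInv pC pB P' m' ∧ P.card < P'.card := by
  obtain ⟨h1, h2, h3⟩ := h
  have hne : (Finset.univ.filter (fun b => (c, b) ∉ P)).Nonempty := by
    by_contra hcon
    have hall : ∀ b, (c, b) ∈ P := by
      intro b
      by_contra hb
      exact hcon ⟨b, by simpa using hb⟩
    choose f hf _ using fun b => h3 c b (hall b)
    have hinj : Function.Injective f := by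
      intro x y hxy
      have hx := hf x
      rw [hxy, hf y] at hx
      exact (Option.some.inj hx).symm
    have hbij := (Fintype.bijective_iff_injective_and_card f).2
      ⟨hinj, le_antisymm (Fintype.card_le_of_injective f hinj) hcard⟩
    obtain ⟨b, hb⟩ := hbij.2 c
    have := hf b
    rw [hb, hc] at this
    cases this
  obtain ⟨b, hb, hmax⟩ := Finset.exists_max_image _ (pC c) hne
  have hbP : (c, b) ∉ P := by simpa using hb
  have hbest : ∀ b', pC c b < pC c b' → (c, b') ∈ P := by
    intro b' hlt
    by_contra hb'
    exact absurd (hmax b' (by simpa using hb')) (not_le.2 hlt)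
  have hcardP : P.card < (insert (c, b) P).card := by
    rw [Finset.card_insert_of_notMem hbP]
    exact Nat.lt_succ_self _
  by_cases hex : ∃ c', m c' = some b ∧ pB b c ≤ pB b c'
  · refine ⟨insert (c, b) P, m, ⟨h1, ?_, ?_⟩, hcardP⟩
    · intro x y y' hx hlt
      exact Finset.mem_insert_of_mem (h2 x y y' hx hlt)
    · intro x y hxy
      rcases Finset.mem_insert.1 hxy with he | he
      · obtain ⟨rfl, rfl⟩ := Prod.mk.inj he
        exact hex
      · exact h3 x y he
  · push Not at hex
    refine ⟨insert (c, b) P, fun x => if x = c then some b else if m x = some b then none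
      else m x, ⟨?_, ?_, ?_⟩, hcardP⟩
    · intro x x' y hx hx'
      have := h1 x x' y
      grind
    · intro x y y' hx hlt
      refine Finset.mem_insert_of_mem ?_
      have := h2 x y y'
      have := hbest y'
      grind
    · intro x y hxy
      by_cases hy : y = b
      · subst hy
        refine ⟨c, by simp, ?_⟩
        rcases Finset.mem_insert.1 hxy with he | he
        · obtain ⟨rfl, _⟩ := Prod.mk.inj he
          exact le_rfl
        · obtain ⟨c', hc', hle⟩ := h3 x y he
          exact hle.trans (hex c' hc').le
      · have he : (x, y) ∈ P := by
          rcases Finset.mem_insert.1 hxy with he | he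
          · exact absurd (Prod.mk.inj he).2 hy
          · exact he
        obtain ⟨c', hc', hle⟩ := h3 x y he
        refine ⟨c', ?_, hle⟩
        grind

/-- Existence of a stable one-to-one matching of all partial-DTs to edge
servers: there is an injective assignment `Φ : C → B` admitting no blocking
pair `(c, b)`, i.e., no pair where `c` strictly prefers `b` to its current
match and `b` strictly prefers `c` to every partial-DT currently matched to
`b`. -/
theorem exists_stable_matching
    {C B : Type*} [Fintype C] [Fintype B] [DecidableEq C] [DecidableEq B]
    (hcard : Fintype.card C ≤ Fintype.card B)
    (pC : C → B → ℝ) (pB : B → C → ℝ) :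
    ∃ Φ : C → B, Function.Injective Φ ∧
      ¬ ∃ (c : C) (b : B), pC c b > pC c (Φ c) ∧
        ∀ c' : C, Φ c' = b → pB b c > pB b c' := by
  classical
  obtain ⟨P, hP, hmax⟩ := Finset.exists_max_image
    (Finset.univ.filter (fun P : Finset (C × B) => ∃ m, DAInv pC pB P m)) Finset.card
    ⟨∅, by simpa using ⟨fun _ => none, by simp [DAInv]⟩⟩
  obtain ⟨m, hm⟩ : ∃ m, DAInv pC pB P m := by simpa using hP
  have htot : ∀ c, ∃ b, m c = some b := by
    intro c
    rcases hc : m c with _ | b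
    · obtain ⟨P', m', hm', hlt⟩ := DAInv.step hcard pC pB P m hm c hc
      exact absurd (hmax P' (by simpa using ⟨m', hm'⟩)) (not_le.2 hlt)
    · exact ⟨b, rfl⟩
  choose Φ hΦ using htot
  obtain ⟨h1, h2, h3⟩ := hm
  refine ⟨Φ, fun x y hxy => h1 x y (Φ y) (hxy ▸ hΦ x) (hΦ y), ?_⟩
  rintro ⟨c, b, hlt, hb⟩
  obtain ⟨c', hc', hle⟩ := h3 c b (h2 c _ b (hΦ c) hlt)
  rw [hΦ c'] at hc'
  exact absurd (hb c' (Option.some.inj hc')) (not_lt.2 hle)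
end
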